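/- Let K be an algebraically closed field, let n, s be natural numbers with s ≤ n, and let V be a K-linear subspace of K[x,y]_n with dim_K V = n+1−s. Suppose dim_K (x·V + y·V) ≤ n+2−s, where x·V + y·V is the subspace of K[x,y]_{n+1} spanned by all xf and yf with f ∈ V. Then there exists a homogeneous polynomial h of degree s such that V = h·K[x,y]_{n−s}. -/

import Mathlib

open MvPolynomial

noncomputable section

/-- The polynomial ring `K[x,y]`. -/
abbrev Pxy (K : Type*) [Field K] := MvPolynomial (Fin 2) K

/-- An ideal of `K[x,y]` is homogeneous if it contains all homogeneous
components of each of its elements. -/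
def IsHomog {K : Type*} [Field K] (I : Ideal (Pxy K)) : Prop :=
  ∀ f ∈ I, ∀ k : ℕ, homogeneousComponent k f ∈ I

/-- The Hilbert function of an ideal:
`t_I(k) = dim_K (K[x,y]_k / (I ∩ K[x,y]_k))`. -/
def hilb (K : Type*) [Field K] (I : Ideal (Pxy K)) (k : ℕ) : ℕ :=
  Module.finrank K
    (homogeneousSubmodule (Fin 2) K k ⧸
      Submodule.comap (homogeneousSubmodule (Fin 2) K k).subtype (I.restrictScalars K))

/-- A linear change of variables: a `K`-algebra automorphism sending the
variables to homogeneous polynomials of degree 1. -/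
def IsLinChange {K : Type*} [Field K] (φ : Pxy K ≃ₐ[K] Pxy K) : Prop :=
  ∀ i : Fin 2, (φ (X i)).IsHomogeneous 1

/-- `t` is of homogeneous finite type: there are finitely many homogeneous ideals
`J₁, …, Jₘ` such that every homogeneous ideal `I` with Hilbert function `t` is
mapped onto some `Jᵢ` by a linear change of variables. -/
def HomogFiniteType (K : Type*) [Field K] (t : ℕ → ℕ) : Prop :=
  ∃ S : Set (Ideal (Pxy K)), S.Finite ∧ (∀ J ∈ S, IsHomog J) ∧
    ∀ I : Ideal (Pxy K), IsHomog I → (∀ k, hilb K I k = t k) →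
      ∃ φ : Pxy K ≃ₐ[K] Pxy K, IsLinChange φ ∧ Ideal.map φ I ∈ S

lemma finrank_homogeneousSubmodule_fin_two (K : Type*) [Field K] (d : ℕ) :
    Module.finrank K (homogeneousSubmodule (Fin 2) K d) = d + 1 := by
  have e : {m : Fin 2 →₀ ℕ | m.degree = d} ≃ Finset.HasAntidiagonal.antidiagonal d :=
    (finTwoArrowEquiv' ℕ).subtypeEquiv fun m => by
      simp [finTwoArrowEquiv', Finsupp.degree_eq_sum]
  rw [homogeneousSubmodule_eq_finsupp_supported]
  change Module.finrank K (restrictSupport K {m : Fin 2 →₀ ℕ | m.degree = d}) = d + 1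
  rw [Module.finrank_eq_nat_card_basis (basisRestrictSupport K {m : Fin 2 →₀ ℕ | m.degree = d}),
    Nat.card_congr e, Nat.card_eq_fintype_card, Fintype.card_coe, Finset.Nat.card_antidiagonal]

lemma mem_homogeneousSubmodule_succ {K : Type*} [Field K] {d : ℕ} {f : MvPolynomial (Fin 2) K}
    (hf : f ∈ homogeneousSubmodule (Fin 2) K (d + 1)) :
    ∃ a ∈ homogeneousSubmodule (Fin 2) K d, ∃ b ∈ homogeneousSubmodule (Fin 2) K d,
      f = X 0 * a + X 1 * b := by
  rw [← homogeneousSubmodule_one_pow, pow_succ', homogeneousSubmodule_one_pow,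
    homogeneousSubmodule_one_eq_span_X] at hf
  have : Set.range (X : Fin 2 → MvPolynomial (Fin 2) K) = {X 0} ∪ {X 1} := by
    ext; simp [eq_comm, or_comm]
  rw [this, Submodule.span_union, Submodule.sup_mul, Submodule.mem_sup] at hf
  obtain ⟨p, hp, q, hq, rfl⟩ := hf
  obtain ⟨a, ha, rfl⟩ := Submodule.mem_span_singleton_mul.1 hp
  obtain ⟨b, hb, rfl⟩ := Submodule.mem_span_singleton_mul.1 hq
  exact ⟨a, ha, b, hb, rfl⟩

lemma homogeneous_of_X_mul {σ K : Type*} [Field K] {d : ℕ} {i : σ} {f : MvPolynomial σ K}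
    (hf : (X i * f).IsHomogeneous (d + 1)) : f.IsHomogeneous d := by
  intro m hm
  have := @hf (Finsupp.single i 1 + m) (by rwa [coeff_X_mul])
  simp only [map_add, Finsupp.weight_single] at this
  simp at this
  omega

lemma exists_of_X_mul_eq_X_mul {K : Type*} [Field K] {f g : MvPolynomial (Fin 2) K}
    (h : X 0 * f = X 1 * g) : ∃ u, f = X 1 * u ∧ g = X 0 * u := by
  have h0 : (X 0 : MvPolynomial (Fin 2) K) ∣ X 1 * g := ⟨f, h.symm⟩
  obtain ⟨u, rfl⟩ := ((X_prime (R := K) (i := (0 : Fin 2))).dvd_or_dvd h0).resolve_left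
    (by simp [X_dvd_X])
  refine ⟨u, mul_left_cancel₀ (X_ne_zero (R := K) (0 : Fin 2)) ?_, rfl⟩
  rw [h]; ring

lemma finrank_map_mulLeft {K A : Type*} [Field K] [CommRing A] [IsDomain A] [Algebra K A] {h : A}
    (hh : h ≠ 0) (V : Submodule K A) :
    Module.finrank K (V.map (LinearMap.mulLeft K h)) = Module.finrank K V :=
  (Submodule.equivMapOfInjective _ (mul_right_injective₀ hh) V).finrank_eq.symm

instance {σ K : Type*} [Finite σ] [Field K] (n : ℕ) :
    FiniteDimensional K (homogeneousSubmodule σ K n) :=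
  Module.Finite.iff_fg.2 (homogeneousSubmodule_fg _ _ n)

/-- If `xW, yW ⊆ V` and `W = h·K[x,y]_d`, then `h·K[x,y]_{d+1} ⊆ V`. -/
lemma map_mulLeft_homogeneousSubmodule_succ_le {K : Type*} [Field K] {d : ℕ}
    {h : MvPolynomial (Fin 2) K} {V : Submodule K (MvPolynomial (Fin 2) K)}
    (hV : ∀ i : Fin 2, (homogeneousSubmodule (Fin 2) K d).map (LinearMap.mulLeft K h) ≤
      V.comap (LinearMap.mulLeft K (X i))) :
    (homogeneousSubmodule (Fin 2) K (d + 1)).map (LinearMap.mulLeft K h) ≤ V := by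
  rintro _ ⟨f, hf, rfl⟩
  obtain ⟨a, ha, b, hb, rfl⟩ := mem_homogeneousSubmodule_succ hf
  have h0 := hV 0 ⟨a, ha, rfl⟩
  have h1 := hV 1 ⟨b, hb, rfl⟩
  simp only [Submodule.mem_comap, LinearMap.mulLeft_apply] at h0 h1 ⊢
  convert V.add_mem h0 h1 using 1
  ring

lemma exists_eq_map_mulLeft_homogeneousSubmodule {K : Type*} [Field K] (n d : ℕ)
    (V : Submodule K (MvPolynomial (Fin 2) K)) (hV : V ≤ homogeneousSubmodule (Fin 2) K n)
    (hdim : Module.finrank K V = d + 1)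
    (hxy : Module.finrank K ↥(V.map (LinearMap.mulLeft K (X 0)) ⊔
      V.map (LinearMap.mulLeft K (X 1))) ≤ d + 2) :
    ∃ s h, s + d = n ∧ h.IsHomogeneous s ∧
      V = (homogeneousSubmodule (Fin 2) K d).map (LinearMap.mulLeft K h) := by
  induction n generalizing d V with
  | zero =>
    have hle := Submodule.finrank_mono hV
    rw [finrank_homogeneousSubmodule_fin_two, hdim] at hle
    obtain rfl : d = 0 := by omega
    refine ⟨0, 1, rfl, isHomogeneous_one _ _, ?_⟩
    rw [LinearMap.mulLeft_one, Submodule.map_id]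
    exact Submodule.eq_of_le_of_finrank_eq hV
      (by rw [hdim, finrank_homogeneousSubmodule_fin_two])
  | succ n ih =>
    have : FiniteDimensional K V := Module.finite_of_finrank_eq_succ hdim
    obtain _ | d := d
    · obtain ⟨v, hv, hv'⟩ := finrank_eq_one_iff'.1 hdim
      refine ⟨n + 1, v, rfl, hV v.2, (Submodule.eq_of_le_of_finrank_eq ?_ ?_).symm⟩
      · rintro _ ⟨f, hf, rfl⟩
        rw [homogeneousSubmodule_zero] at hf
        obtain ⟨c, rfl⟩ := Submodule.mem_one.1 hf
        rw [LinearMap.mulLeft_apply, mul_comm, ← Algebra.smul_def]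
        exact V.smul_mem c v.2
      · rw [finrank_map_mulLeft (by simpa using hv), finrank_homogeneousSubmodule_fin_two, hdim]
    let W : Submodule K (MvPolynomial (Fin 2) K) :=
      V.comap (LinearMap.mulLeft K (X 0)) ⊓ V.comap (LinearMap.mulLeft K (X 1))
    have hWn : W ≤ homogeneousSubmodule (Fin 2) K n := fun w hw => homogeneous_of_X_mul (hV hw.1)
    have hWV : ∀ i : Fin 2, W ≤ V.comap (LinearMap.mulLeft K (X i)) := by
      intro i
      fin_cases i
      exacts [inf_le_left, inf_le_right]
    have : FiniteDimensional K W := Submodule.finiteDimensional_of_le hWn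
    have hsup : W.map (LinearMap.mulLeft K (X 0)) ⊔ W.map (LinearMap.mulLeft K (X 1)) ≤ V :=
      sup_le (Submodule.map_le_iff_le_comap.2 (hWV 0)) (Submodule.map_le_iff_le_comap.2 (hWV 1))
    have hsup' := Submodule.finrank_mono hsup
    have hW_le : Module.finrank K W ≤ d + 2 := by
      rw [← hdim, ← finrank_map_mulLeft (X_ne_zero (R := K) (0 : Fin 2)) W]
      exact Submodule.finrank_mono (le_sup_left.trans hsup)
    have hinf : V.map (LinearMap.mulLeft K (X 0)) ⊓ V.map (LinearMap.mulLeft K (X 1)) ≤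
        W.map (LinearMap.mulLeft K (X 0 * X 1)) := by
      rintro _ ⟨⟨f, hf, rfl⟩, ⟨g, hg, hfg⟩⟩
      obtain ⟨u, rfl, rfl⟩ := exists_of_X_mul_eq_X_mul hfg.symm
      refine ⟨u, ⟨hg, hf⟩, ?_⟩
      simp
    have hle_W : d + 1 ≤ Module.finrank K W := by
      have h1 := Submodule.finrank_mono hinf
      have h2 := Submodule.finrank_sup_add_finrank_inf_eq
        (V.map (LinearMap.mulLeft K (X 0))) (V.map (LinearMap.mulLeft K (X 1)))
      rw [finrank_map_mulLeft (mul_ne_zero (X_ne_zero _) (X_ne_zero _))] at h1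
      rw [finrank_map_mulLeft (X_ne_zero _), finrank_map_mulLeft (X_ne_zero _)] at h2
      omega
    obtain ⟨e, he, hde⟩ : ∃ e, Module.finrank K W = e + 1 ∧ d ≤ e :=
      ⟨Module.finrank K W - 1, by omega, by omega⟩
    obtain ⟨s, h, hs, hh, hWh⟩ := ih e W hWn he (by omega)
    have hh0 : h ≠ 0 := by
      rintro rfl
      rw [hWh, LinearMap.mulLeft_zero_eq_zero, Submodule.map_zero, finrank_bot] at he
      omega
    have hle := map_mulLeft_homogeneousSubmodule_succ_le fun i => hWh ▸ hWV i
    have hle' := Submodule.finrank_mono hle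
    rw [finrank_map_mulLeft hh0, finrank_homogeneousSubmodule_fin_two, hdim] at hle'
    obtain rfl : e = d := by omega
    exact ⟨s, h, by omega, hh, (Submodule.eq_of_le_of_finrank_eq hle (by
      rw [finrank_map_mulLeft hh0, finrank_homogeneousSubmodule_fin_two, hdim])).symm⟩

/-- If `V ⊆ K[x,y]_n` has dimension `n+1-s` and `dim (x·V + y·V) ≤ n+2-s`,
then `V = h·K[x,y]_{n-s}` for some homogeneous `h` of degree `s`. -/
theorem stmt8 (K : Type*) [Field K] [IsAlgClosed K] (n s : ℕ) (hs : s ≤ n)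
    (V : Submodule K (Pxy K)) (hV : V ≤ homogeneousSubmodule (Fin 2) K n)
    (hdim : Module.finrank K V = n + 1 - s)
    (hxy : Module.finrank K ↥
        (Submodule.map (LinearMap.mulLeft K (X 0 : Pxy K)) V ⊔
          Submodule.map (LinearMap.mulLeft K (X 1 : Pxy K)) V) ≤ n + 2 - s) :
    ∃ h : Pxy K, h.IsHomogeneous s ∧
      V = Submodule.map (LinearMap.mulLeft K h)
        (homogeneousSubmodule (Fin 2) K (n - s)) := by
  obtain ⟨t, h, ht, hh, hVh⟩ :=
    exists_eq_map_mulLeft_homogeneousSubmodule n (n - s) V hV (hdim.trans (by omega))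
      (hxy.trans (by omega))
  obtain rfl : t = s := by omega
  exact ⟨h, hh, hVh⟩
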